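/- arXiv:2311.18425 — 2 statements merged into one kernel-verified Lean document; each statement's English description precedes it below -/
import Mathlib

section
/- Let G' = (V', E') be a finite simple graph containing a clique of size δ, where δ is a positive integer, let ε > 0, and set M = |V'| + ε. Define f : 2^{V'} → ℝ≥0 by f(S) = (M + 1[S is a clique in G'])·|S| + min(|S|, δ)·ε. Let T be any clique of G' with |T| = δ and let α be a real with M/(M + 1 + ε) ≤ α < M/(M + 1). Then: (a) every S ⊆ V' with |S| > δ satisfies α·f(S) − M·|S| < α·f(T) − M·|T|; (b) every S ⊆ V' with |S| ≤ δ satisfies α·f(S) − M·|S| ≤ α·f(T) − M·|T| and f(S) ≤ f(T). Consequently the agent's best response (breaking ties in favor of the larger f-value) is a clique of size δ. -/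
open Classical in
open Classical in
/-- The success probability function
`f(S) = (M + 1[S is a clique in G]) · |S| + min(|S|, δ) · ε`. -/
noncomputable def cliqueF {V' : Type*} (G : SimpleGraph V') (M : ℝ) (δ : ℕ) (ε : ℝ)
    (S : Finset V') : ℝ :=
  (M + (if G.IsClique (S : Set V') then (1 : ℝ) else 0)) * S.card + ((min S.card δ : ℕ) : ℝ) * ε

theorem cliqueF_le {V' : Type*} (G : SimpleGraph V') (M : ℝ) (δ : ℕ) (ε : ℝ)
    (S : Finset V') :
    cliqueF G M δ ε S ≤ (M + 1) * S.card + ((min S.card δ : ℕ) : ℝ) * ε := by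
  unfold cliqueF
  gcongr
  split_ifs <;> norm_num

theorem cliqueF_eq_of_isClique {V' : Type*} {G : SimpleGraph V'} (M : ℝ) (ε : ℝ)
    {T : Finset V'} (hT : G.IsClique (T : Set V')) :
    cliqueF G M T.card ε T = (M + 1 + ε) * T.card := by
  simp only [cliqueF, if_pos hT, min_self]
  ring

theorem stmt13 {V' : Type*} [Fintype V'] [DecidableEq V'] (G : SimpleGraph V')
    (δ : ℕ) (hδ : 0 < δ) (ε : ℝ) (hε : 0 < ε)
    (M : ℝ) (hM : M = (Fintype.card V' : ℝ) + ε)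
    (T : Finset V') (hT : G.IsClique (T : Set V')) (hTcard : T.card = δ)
    (α : ℝ) (hα1 : M / (M + 1 + ε) ≤ α) (hα2 : α < M / (M + 1)) :
    (∀ S : Finset V', δ < S.card →
        α * cliqueF G M δ ε S - M * S.card < α * cliqueF G M δ ε T - M * T.card) ∧
    (∀ S : Finset V', S.card ≤ δ →
        α * cliqueF G M δ ε S - M * S.card ≤ α * cliqueF G M δ ε T - M * T.card ∧
        cliqueF G M δ ε S ≤ cliqueF G M δ ε T) := by
  have hMpos : 0 < M := by rw [hM]; positivity
  have hα : 0 < α := lt_of_lt_of_le (by positivity) hα1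
  rw [div_le_iff₀ (by positivity)] at hα1
  rw [lt_div_iff₀ (by positivity)] at hα2
  subst hTcard
  rw [cliqueF_eq_of_isClique M ε hT]
  refine ⟨fun S hS => ?_, fun S hS => ?_⟩ <;>
    have hle := cliqueF_le G M T.card ε S
  · rw [min_eq_right hS.le] at hle
    have hcard : (T.card : ℝ) < S.card := by exact_mod_cast hS
    nlinarith [mul_le_mul_of_nonneg_left hle hα.le,
      mul_lt_mul_of_pos_left hcard (sub_pos.2 hα2)]
  · rw [min_eq_left hS] at hle
    have hcard : (S.card : ℝ) ≤ T.card := by exact_mod_cast hS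
    have hf : cliqueF G M T.card ε S ≤ (M + 1 + ε) * S.card := by linarith
    refine ⟨?_, hf.trans (by gcongr)⟩
    nlinarith [mul_le_mul_of_nonneg_left hf hα.le,
      mul_le_mul_of_nonneg_left hcard (sub_nonneg.2 hα1)]
end

section
/- Let G' = (V', E') be a finite simple graph containing a clique of size δ, where δ is a positive integer, let ε > 0, and set M = |V'| + ε. Define f : 2^{V'} → ℝ≥0 by f(S) = (M + 1[S is a clique in G'])·|S| + min(|S|, δ)·ε. Let T be a maximum-size clique of G' (so |T| ≥ δ) and let α be a real with M/(M + 1) ≤ α < 1. Then: (a) every S ⊆ V' with |S| > |T| satisfies α·f(S) − M·|S| < α·f(T) − M·|T|; (b) every S ⊆ V' with |S| ≤ |T| satisfies α·f(S) − M·|S| ≤ α·f(T) − M·|T| and f(S) ≤ f(T). Consequently the agent's best response (breaking ties in favor of the larger f-value) is a maximum-size clique. -/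
theorem stmt14 {V' : Type*} [Fintype V'] [DecidableEq V'] (G : SimpleGraph V')
    (δ : ℕ) (hδ : 0 < δ) (ε : ℝ) (hε : 0 < ε)
    (M : ℝ) (hM : M = (Fintype.card V' : ℝ) + ε)
    (hclique : ∃ D : Finset V', G.IsClique (D : Set V') ∧ D.card = δ)
    (T : Finset V') (hT : G.IsClique (T : Set V'))
    (hTmax : ∀ T' : Finset V', G.IsClique (T' : Set V') → T'.card ≤ T.card)
    (α : ℝ) (hα1 : M / (M + 1) ≤ α) (hα2 : α < 1) :
    (∀ S : Finset V', T.card < S.card →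
        α * cliqueF G M δ ε S - M * S.card < α * cliqueF G M δ ε T - M * T.card) ∧
    (∀ S : Finset V', S.card ≤ T.card →
        α * cliqueF G M δ ε S - M * S.card ≤ α * cliqueF G M δ ε T - M * T.card ∧
        cliqueF G M δ ε S ≤ cliqueF G M δ ε T) := by
  have hMpos : 0 < M := by rw [hM]; positivity
  have hα0 : 0 < α := lt_of_lt_of_le (by positivity) hα1
  have hα : M ≤ α * (M + 1) := (div_le_iff₀ (by positivity)).mp hα1
  have hδT : δ ≤ T.card := by
    obtain ⟨D, hD, rfl⟩ := hclique
    exact hTmax D hD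
  have hfT : cliqueF G M δ ε T = (M + 1) * T.card + δ * ε := by
    simp [cliqueF, hT, hδT]
  rw [hfT]
  refine ⟨fun S hS => ?_, fun S hS => ?_⟩
  · have hSc : ¬ G.IsClique (S : Set V') := fun h => (hTmax S h).not_gt hS
    have hfS : cliqueF G M δ ε S = M * S.card + δ * ε := by
      simp [cliqueF, hSc, hδT.trans hS.le]
    have hSpos : (0 : ℝ) < S.card := by exact_mod_cast Nat.zero_lt_of_lt hS
    have h1 : 0 < (1 - α) * (M * S.card) := mul_pos (sub_pos.mpr hα2) (by positivity)
    have h2 : 0 ≤ (α * (M + 1) - M) * T.card :=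
      mul_nonneg (sub_nonneg.mpr hα) (Nat.cast_nonneg _)
    rw [hfS]
    linarith
  · have hST : (S.card : ℝ) ≤ T.card := by exact_mod_cast hS
    have hfS : cliqueF G M δ ε S ≤ (M + 1) * S.card + δ * ε := by
      unfold cliqueF
      gcongr
      · split_ifs <;> norm_num
      · exact min_le_right _ _
    constructor
    · have h1 := mul_le_mul_of_nonneg_left hfS hα0.le
      have h2 := mul_le_mul_of_nonneg_left hST (sub_nonneg.mpr hα)
      linarith
    · refine hfS.trans ?_
      gcongr
end
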